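/- arXiv:1006.2567 — 3 statements merged into one kernel-verified Lean document; each statement's English description precedes it below -/
import Mathlib

section
/- Let Q = [0,1] × [0,1] ⊆ ℝ². For every continuous map f : Q → Q and every ε > 0 there exist real polynomials p₁, p₂ in two variables such that the map p = (p₁, p₂) restricted to Q maps Q into Q, satisfies sup_{z ∈ Q} ‖f(z) − p(z)‖ ≤ ε, and the fixed point set {z ∈ Q | p(z) = z} is a finite set of odd cardinality. -/
open Set

/-- A nowhere vanishing continuous complex function on a compact set that is star-shaped about the
origin has a continuous logarithm. -/
theorem exists_continuousOn_log {E : Type*} [NormedAddCommGroup E] [NormedSpace ℝ E] {K : Set E}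
    (hK : IsCompact K) (hstar : ∀ z ∈ K, ∀ t ∈ Icc (0 : ℝ) 1, t • z ∈ K) {Φ : E → ℂ}
    (hΦ : ContinuousOn Φ K) (hne : ∀ z ∈ K, Φ z ≠ 0) :
    ∃ L : E → ℂ, ContinuousOn L K ∧ (∀ z ∈ K, Complex.exp (L z) = Φ z) ∧
      L 0 = Complex.log (Φ 0) := by
  rcases K.eq_empty_or_nonempty with rfl | hKne
  · exact ⟨fun z => Complex.log (Φ z), by simp, by simp, rfl⟩
  obtain ⟨z₁, hz₁, hmin⟩ := hK.exists_isMinOn hKne hΦ.norm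
  have hm : 0 < ‖Φ z₁‖ := norm_pos_iff.2 (hne z₁ hz₁)
  obtain ⟨δ, hδ, hunif⟩ := Metric.uniformContinuousOn_iff.1
    (hK.uniformContinuousOn_of_continuous hΦ) _ hm
  obtain ⟨R, hR⟩ := hK.isBounded.exists_norm_le
  obtain ⟨n, hn⟩ := exists_nat_gt (R / δ)
  have hR0 : 0 ≤ R := (norm_nonneg _).trans (hR z₁ hz₁)
  have hn0 : (0 : ℝ) < n := (div_nonneg hR0 hδ.le).trans_lt hn
  have hmem : ∀ z ∈ K, ∀ k : ℕ, k ≤ n → ((k : ℝ) / n) • z ∈ K := fun z hz k hk =>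
    hstar z hz _ ⟨by positivity, (div_le_one hn0).2 (by exact_mod_cast hk)⟩
  have h0 : (0 : E) ∈ K := by simpa using hstar z₁ hz₁ 0 (by simp)
  have hslit : ∀ z ∈ K, ∀ k < n,
      Φ (((k + 1 : ℕ) / (n : ℝ)) • z) / Φ (((k : ℕ) / (n : ℝ)) • z) ∈ Complex.slitPlane := by
    intro z hz k hk
    have hb := hmem z hz k hk.le
    have hpos : 0 < ‖Φ (((k : ℕ) / (n : ℝ)) • z)‖ := norm_pos_iff.2 (hne _ hb)
    have hd : dist (((k + 1 : ℕ) / (n : ℝ)) • z) (((k : ℕ) / (n : ℝ)) • z) < δ := by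
      rw [dist_eq_norm, ← sub_smul, norm_smul]
      have : ((k + 1 : ℕ) / (n : ℝ)) - k / n = 1 / n := by push_cast; ring
      rw [this, Real.norm_of_nonneg (by positivity), one_div_mul_eq_div, div_lt_iff₀ hn0]
      rw [div_lt_iff₀ hδ] at hn
      linarith [hR z hz]
    have hlt := (hunif _ (hmem z hz (k + 1) hk) _ hb hd).trans_le (hmin hb)
    have := Complex.mem_slitPlane_of_norm_lt_one
      (z := Φ (((k + 1 : ℕ) / (n : ℝ)) • z) / Φ (((k : ℕ) / (n : ℝ)) • z) - 1) (by
        rw [div_sub_one (hne _ hb), norm_div, div_lt_one hpos, ← dist_eq_norm]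
        exact hlt)
    simpa using this
  refine ⟨fun z => Complex.log (Φ 0) + ∑ k ∈ Finset.range n,
    Complex.log (Φ (((k + 1 : ℕ) / (n : ℝ)) • z) / Φ (((k : ℕ) / (n : ℝ)) • z)), ?_, ?_, ?_⟩
  · refine continuousOn_const.add (continuousOn_finsetSum _ fun k hk => ?_)
    have hk' := Finset.mem_range.1 hk
    refine ContinuousOn.clog (ContinuousOn.div ?_ ?_ fun z hz => hne _ (hmem z hz k hk'.le))
      fun z hz => hslit z hz k hk'
    · exact hΦ.comp (by fun_prop) fun z hz => hmem z hz (k + 1) hk'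
    · exact hΦ.comp (by fun_prop) fun z hz => hmem z hz k hk'.le
  · intro z hz
    have key : ∀ j ≤ n, Complex.exp (Complex.log (Φ 0) + ∑ k ∈ Finset.range j,
        Complex.log (Φ (((k + 1 : ℕ) / (n : ℝ)) • z) / Φ (((k : ℕ) / (n : ℝ)) • z)))
        = Φ (((j : ℕ) / (n : ℝ)) • z) := by
      intro j
      induction j with
      | zero => intro _; simp [Complex.exp_log (hne 0 h0)]
      | succ j ih =>
        intro hj
        rw [Finset.sum_range_succ, ← add_assoc, Complex.exp_add, ih (by omega), Complex.exp_log
          (Complex.slitPlane_ne_zero (hslit z hz j hj)),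
          mul_div_cancel₀ _ (hne _ (hmem z hz j (by omega)))]
    simpa [div_self hn0.ne'] using key n le_rfl
  · simp [div_self (hne 0 h0)]

/-- A continuous function on an interval stays between two values that it avoids. -/
theorem mem_Ioo_of_avoids {θ : ℝ → ℝ} (hθ : ContinuousOn θ (Icc 0 1)) {c d s t : ℝ}
    (hc : ∀ x ∈ Icc (0 : ℝ) 1, θ x ≠ c) (hd : ∀ x ∈ Icc (0 : ℝ) 1, θ x ≠ d)
    (hs : s ∈ Icc (0 : ℝ) 1) (ht : t ∈ Icc (0 : ℝ) 1) (h : θ s ∈ Ioo c d) : θ t ∈ Ioo c d := by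
  have hsub : uIcc s t ⊆ Icc 0 1 := uIcc_subset_Icc hs ht
  have himg := intermediate_value_uIcc (hθ.mono hsub)
  by_contra hcon
  rw [mem_Ioo, not_and_or, not_lt, not_lt] at hcon
  rcases hcon with hcon | hcon
  · obtain ⟨x, hx, hxc⟩ := himg (mem_uIcc_of_ge hcon h.1.le)
    exact hc x (hsub hx) hxc
  · obtain ⟨x, hx, hxd⟩ := himg (mem_uIcc_of_le h.2.le hcon)
    exact hd x (hsub hx) hxd

/-- A continuous map of the closed unit square into its interior has a fixed point. -/
theorem exists_fixedPoint_of_mapsTo_interior {g : ℝ × ℝ → ℝ × ℝ}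
    (hg : ContinuousOn g (Icc (0 : ℝ) 1 ×ˢ Icc (0 : ℝ) 1))
    (hmaps : MapsTo g (Icc (0 : ℝ) 1 ×ˢ Icc (0 : ℝ) 1) (Ioo (0 : ℝ) 1 ×ˢ Ioo (0 : ℝ) 1)) :
    ∃ z ∈ Icc (0 : ℝ) 1 ×ˢ Icc (0 : ℝ) 1, g z = z := by
  by_contra! hfix
  set Q : Set (ℝ × ℝ) := Icc (0 : ℝ) 1 ×ˢ Icc (0 : ℝ) 1
  set Φ : ℝ × ℝ → ℂ := fun z => Complex.equivRealProdCLM.symm (g z - z)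
  have hre : ∀ z, (Φ z).re = (g z).1 - z.1 := fun z => by
    rfl
  have him : ∀ z, (Φ z).im = (g z).2 - z.2 := fun z => by
    rfl
  obtain ⟨L, hL, hexp, hL0⟩ := exists_continuousOn_log (K := Q) (Φ := Φ)
    (isCompact_Icc.prod isCompact_Icc)
    (fun z hz t ht => by
      obtain ⟨⟨h1, h2⟩, h3, h4⟩ := hz
      exact ⟨⟨mul_nonneg ht.1 h1, mul_le_one₀ ht.2 h1 h2⟩,
        mul_nonneg ht.1 h3, mul_le_one₀ ht.2 h3 h4⟩)
    (Complex.equivRealProdCLM.symm.continuous.comp_continuousOn (hg.sub continuousOn_id))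
    (fun z hz h => hfix z hz (sub_eq_zero.1 (by simpa [Φ, -map_sub] using h)))
  set θ : ℝ → ℝ → ℝ := fun x y => (L (x, y)).im
  have hcos : ∀ x ∈ Icc (0 : ℝ) 1, ∀ y ∈ Icc (0 : ℝ) 1, ∃ r > 0,
      (g (x, y)).1 - x = r * Real.cos (θ x y) ∧ (g (x, y)).2 - y = r * Real.sin (θ x y) :=
    fun x hx y hy => ⟨Real.exp (L (x, y)).re, Real.exp_pos _,
      by rw [← hre (x, y), ← hexp _ ⟨hx, hy⟩, Complex.exp_re],
      by rw [← him (x, y), ← hexp _ ⟨hx, hy⟩, Complex.exp_im]⟩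
  have h0 : (0 : ℝ) ∈ Icc (0 : ℝ) 1 := by simp
  have h1 : (1 : ℝ) ∈ Icc (0 : ℝ) 1 := by simp
  have hleft : ∀ y ∈ Icc (0 : ℝ) 1, 0 < Real.cos (θ 0 y) := fun y hy => by
    obtain ⟨r, hr, h, -⟩ := hcos 0 h0 y hy
    have := (hmaps (show ((0 : ℝ), y) ∈ Q from ⟨h0, hy⟩)).1.1
    exact pos_of_mul_pos_right (by linarith) hr.le
  have hright : ∀ y ∈ Icc (0 : ℝ) 1, Real.cos (θ 1 y) < 0 := fun y hy => by
    obtain ⟨r, hr, h, -⟩ := hcos 1 h1 y hy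
    have := (hmaps (show ((1 : ℝ), y) ∈ Q from ⟨h1, hy⟩)).1.2
    exact neg_of_mul_neg_right (by linarith) hr.le
  have hbot : ∀ x ∈ Icc (0 : ℝ) 1, 0 < Real.sin (θ x 0) := fun x hx => by
    obtain ⟨r, hr, -, h⟩ := hcos x hx 0 h0
    have := (hmaps (show (x, (0 : ℝ)) ∈ Q from ⟨hx, h0⟩)).2.1
    exact pos_of_mul_pos_right (by linarith) hr.le
  have htop : ∀ x ∈ Icc (0 : ℝ) 1, Real.sin (θ x 1) < 0 := fun x hx => by
    obtain ⟨r, hr, -, h⟩ := hcos x hx 1 h1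
    have := (hmaps (show (x, (1 : ℝ)) ∈ Q from ⟨hx, h1⟩)).2.2
    exact neg_of_mul_neg_right (by linarith) hr.le
  have hcx : ∀ y ∈ Icc (0 : ℝ) 1, ContinuousOn (fun x => θ x y) (Icc 0 1) := fun y hy =>
    Complex.continuous_im.comp_continuousOn (hL.comp (by fun_prop) fun x hx => ⟨hx, hy⟩)
  have hcy : ∀ x ∈ Icc (0 : ℝ) 1, ContinuousOn (fun y => θ x y) (Icc 0 1) := fun x hx =>
    Complex.continuous_im.comp_continuousOn (hL.comp (by fun_prop) fun y hy => ⟨hx, hy⟩)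
  have hcos3 : Real.cos (3 * Real.pi / 2) = 0 := by
    rw [show 3 * Real.pi / 2 = Real.pi / 2 + Real.pi by ring, Real.cos_add_pi]; simp
  have hpi := Real.pi_pos
  have harg : θ 0 0 = (Φ 0).arg := by
    change (L 0).im = _
    rw [hL0, Complex.log_im]
  have hle := Complex.arg_le_pi (Φ 0)
  have hgt := Complex.neg_pi_lt_arg (Φ 0)
  rw [← harg] at hle hgt
  have A0 : 0 < θ 0 0 := by
    by_contra! h
    exact (hbot 0 h0).not_ge (Real.sin_nonpos_of_nonpos_of_neg_pi_le h hgt.le)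
  have A1 : θ 0 0 < Real.pi / 2 := by
    by_contra! h
    exact (hleft 0 h0).not_ge (Real.cos_nonpos_of_pi_div_two_le_of_le h (by linarith))
  have B := mem_Ioo_of_avoids (c := 0) (d := Real.pi) (hcx 0 h0)
    (fun x hx h => by have := hbot x hx; simp [h] at this)
    (fun x hx h => by have := hbot x hx; simp [h] at this) h0 h1 ⟨A0, by linarith⟩
  have B1 : Real.pi / 2 < θ 1 0 := by
    by_contra! h
    exact (hright 0 h0).not_ge (Real.cos_nonneg_of_neg_pi_div_two_le_of_le (by linarith [B.1]) h)
  have C := mem_Ioo_of_avoids (c := Real.pi / 2) (d := 3 * Real.pi / 2) (hcy 1 h1)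
    (fun x hx h => by have := hright x hx; simp [h] at this)
    (fun x hx h => by have := hright x hx; simp [h, hcos3] at this) h0 h1
    ⟨B1, by linarith [B.2]⟩
  have C1 : Real.pi < θ 1 1 := by
    by_contra! h
    exact (htop 1 h1).not_ge (Real.sin_nonneg_of_nonneg_of_le_pi (by linarith [C.1]) h)
  have D := mem_Ioo_of_avoids (c := Real.pi) (d := 2 * Real.pi) (hcx 1 h1)
    (fun x hx h => by have := htop x hx; simp [h] at this)
    (fun x hx h => by have := htop x hx; simp [h] at this) h1 h0 ⟨C1, by linarith [C.2]⟩
  have D1 : 3 * Real.pi / 2 < θ 0 1 := by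
    by_contra! h
    exact (hleft 1 h1).not_ge
      (Real.cos_nonpos_of_pi_div_two_le_of_le (by linarith [D.1]) (by linarith))
  have E := mem_Ioo_of_avoids (c := 3 * Real.pi / 2) (d := 2 * Real.pi + Real.pi / 2) (hcy 0 h0)
    (fun x hx h => by have := hleft x hx; simp [h, hcos3] at this)
    (fun x hx h => by have := hleft x hx; simp [h, add_comm, Real.cos_add_two_pi] at this) h1 h0
    ⟨D1, by linarith [D.2]⟩
  linarith [E.1]

section

open MeasureTheory Topology Filter

/-- A `C¹` self-map of a finite-dimensional space attains some arbitrarily small values only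
finitely often on a given compact set. -/
theorem exists_small_finite_fiber {E : Type*} [NormedAddCommGroup E] [NormedSpace ℝ E]
    [FiniteDimensional ℝ E] {Ψ : E → E} (hΨ : Differentiable ℝ Ψ) {K : Set E} (hK : IsCompact K)
    {η : ℝ} (hη : 0 < η) : ∃ c, ‖c‖ < η ∧ {z ∈ K | Ψ z = c}.Finite := by
  borelize E
  have hnull : Measure.addHaar (Ψ '' {z | (fderiv ℝ Ψ z).det = 0}) = 0 :=
    addHaar_image_eq_zero_of_det_fderivWithin_eq_zero _
      (fun z _ => (hΨ z).hasFDerivAt.hasFDerivWithinAt) fun z hz => hz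
  obtain ⟨c, hc, hreg⟩ : ∃ c ∈ Metric.ball (0 : E) η, c ∉ Ψ '' {z | (fderiv ℝ Ψ z).det = 0} := by
    by_contra! h
    exact (Metric.measure_ball_pos Measure.addHaar (0 : E) hη).ne' (measure_mono_null h hnull)
  refine ⟨c, by simpa using hc, ?_⟩
  by_contra hinf
  obtain ⟨z, hz, hacc⟩ := Set.Infinite.exists_accPt_of_subset_isCompact hinf hK fun z hz => hz.1
  have hfreq := accPt_iff_frequently_nhdsNE.1 hacc
  have hzc : Ψ z = c := by
    by_contra hne
    exact hfreq ((((hΨ z).continuousAt.eventually_ne hne).filter_mono nhdsWithin_le_nhds).mono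
      fun y hy hy' => hy hy'.2)
  have hdet : (fderiv ℝ Ψ z).det ≠ 0 := fun h => hreg ⟨z, h, hzc⟩
  set e := (fderiv ℝ Ψ z).toContinuousLinearEquivOfDetNeZero hdet
  exact hfreq (((hΨ z).hasFDerivAt.eventually_ne (c := c)
    ⟨_, e.antilipschitz⟩).mono
      fun y hy hy' => hy hy'.2)

/-- Weierstrass approximation by polynomials in two variables. -/
theorem exists_mvPolynomial_near {K : Set (ℝ × ℝ)} (hK : IsCompact K) {f : ℝ × ℝ → ℝ}
    (hf : ContinuousOn f K) {ε : ℝ} (hε : 0 < ε) :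
    ∃ p : MvPolynomial (Fin 2) ℝ, ∀ z ∈ K, |MvPolynomial.eval ![z.1, z.2] p - f z| < ε := by
  have : CompactSpace K := isCompact_iff_compactSpace.1 hK
  let v : Fin 2 → C(K, ℝ) := ![⟨fun z => z.1.1, by fun_prop⟩, ⟨fun z => z.1.2, by fun_prop⟩]
  have hv : ∀ (p : MvPolynomial (Fin 2) ℝ) (z : K),
      MvPolynomial.aeval v p z = MvPolynomial.eval ![z.1.1, z.1.2] p := by
    intro p z
    induction p using MvPolynomial.induction_on with
    | C a => simp
    | add p q hp hq => simp [hp, hq]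
    | mul_X p i hp => fin_cases i <;> simp [hp, v]
  have hsep : (MvPolynomial.aeval v : MvPolynomial (Fin 2) ℝ →ₐ[ℝ] C(K, ℝ)).range.SeparatesPoints := by
    intro x y hxy
    have : x.1.1 ≠ y.1.1 ∨ x.1.2 ≠ y.1.2 := by
      by_contra! h
      exact hxy (Subtype.ext (Prod.ext h.1 h.2))
    rcases this with h | h
    · exact ⟨_, ⟨v 0, ⟨MvPolynomial.X 0, by simp⟩, rfl⟩, h⟩
    · exact ⟨_, ⟨v 1, ⟨MvPolynomial.X 1, by simp⟩, rfl⟩, h⟩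
  obtain ⟨⟨_, p, rfl⟩, hp⟩ :=
    ContinuousMap.exists_mem_subalgebra_near_continuous_of_separatesPoints _ hsep
      (K.domRestrict f) hf.domRestrict ε hε
  refine ⟨p, fun z hz => ?_⟩
  have := hp ⟨z, hz⟩
  rw [← hv p ⟨z, hz⟩]
  exact this

/-- The map of the plane given by a pair of polynomials in two variables. -/
noncomputable abbrev polyMap (p₁ p₂ : MvPolynomial (Fin 2) ℝ) (z : ℝ × ℝ) : ℝ × ℝ :=
  (MvPolynomial.eval ![z.1, z.2] p₁, MvPolynomial.eval ![z.1, z.2] p₂)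

theorem differentiable_eval_pair (p : MvPolynomial (Fin 2) ℝ) :
    Differentiable ℝ fun z : ℝ × ℝ => MvPolynomial.eval ![z.1, z.2] p := by
  induction p using MvPolynomial.induction_on with
  | C a => simp
  | add p q hp hq => simpa using hp.fun_add hq
  | mul_X p i hp =>
    fin_cases i
    · simpa using hp.fun_mul differentiable_fst
    · simpa using hp.fun_mul differentiable_snd

theorem differentiable_polyMap (p₁ p₂ : MvPolynomial (Fin 2) ℝ) :
    Differentiable ℝ (polyMap p₁ p₂) :=
  (differentiable_eval_pair p₁).prodMk (differentiable_eval_pair p₂)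

/-- A continuous self-map of the unit square is approximated by polynomial maps into the open
square with finitely many fixed points. -/
theorem exists_polyMap_near_finite_fixedPoints {f : ℝ × ℝ → ℝ × ℝ}
    (hf : ContinuousOn f (Icc (0 : ℝ) 1 ×ˢ Icc (0 : ℝ) 1))
    (hmaps : MapsTo f (Icc (0 : ℝ) 1 ×ˢ Icc (0 : ℝ) 1) (Icc (0 : ℝ) 1 ×ˢ Icc (0 : ℝ) 1))
    {ε : ℝ} (hε : 0 < ε) :
    ∃ p₁ p₂ : MvPolynomial (Fin 2) ℝ,
      MapsTo (polyMap p₁ p₂) (Icc (0 : ℝ) 1 ×ˢ Icc (0 : ℝ) 1) (Ioo (0 : ℝ) 1 ×ˢ Ioo (0 : ℝ) 1) ∧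
      (∀ z ∈ Icc (0 : ℝ) 1 ×ˢ Icc (0 : ℝ) 1, ‖f z - polyMap p₁ p₂ z‖ ≤ ε) ∧
      {z ∈ Icc (0 : ℝ) 1 ×ˢ Icc (0 : ℝ) 1 | polyMap p₁ p₂ z = z}.Finite := by
  set Q : Set (ℝ × ℝ) := Icc (0 : ℝ) 1 ×ˢ Icc (0 : ℝ) 1
  have hQ : IsCompact Q := isCompact_Icc.prod isCompact_Icc
  obtain ⟨δ, hδ, hδε, hδ1⟩ : ∃ δ > 0, δ ≤ ε ∧ δ ≤ 1 :=
    ⟨min ε 1, by positivity, min_le_left _ _, min_le_right _ _⟩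
  obtain ⟨q₁, hq₁⟩ := exists_mvPolynomial_near hQ (f := fun z => (1 - δ) * (f z).1 + δ / 2)
    (by fun_prop) (show 0 < δ / 4 by positivity)
  obtain ⟨q₂, hq₂⟩ := exists_mvPolynomial_near hQ (f := fun z => (1 - δ) * (f z).2 + δ / 2)
    (by fun_prop) (show 0 < δ / 4 by positivity)
  obtain ⟨c, hc, hfin⟩ := exists_small_finite_fiber
    ((differentiable_polyMap q₁ q₂).sub differentiable_id) hQ (show 0 < δ / 8 by positivity)
  have hc₁ := abs_lt.1 ((norm_fst_le c).trans_lt hc)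
  have hc₂ := abs_lt.1 ((norm_snd_le c).trans_lt hc)
  have hnear : ∀ a b s : ℝ, a ∈ Icc (0 : ℝ) 1 → |b - ((1 - δ) * a + δ / 2)| < δ / 4 →
      -(δ / 8) < s → s < δ / 8 → b - s ∈ Ioo (0 : ℝ) 1 ∧ |a - (b - s)| ≤ ε := by
    intro a b s ha hb hs hs'
    rw [abs_lt] at hb
    have h1 := mul_nonneg hδ.le ha.1
    have h2 := mul_nonneg hδ.le (sub_nonneg.2 ha.2)
    have h3 := mul_nonneg (sub_nonneg.2 hδ1) ha.1
    have h4 := mul_nonneg (sub_nonneg.2 hδ1) (sub_nonneg.2 ha.2)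
    refine ⟨⟨by linarith, by linarith⟩, abs_le.2 ⟨by linarith, by linarith⟩⟩
  refine ⟨q₁ - MvPolynomial.C c.1, q₂ - MvPolynomial.C c.2, fun z hz => ?_, fun z hz => ?_,
    hfin.subset fun z hz => ⟨hz.1, ?_⟩⟩
  · simpa [polyMap] using And.intro
      (hnear _ _ _ (hmaps hz).1 (hq₁ z hz) hc₁.1 hc₁.2).1
      (hnear _ _ _ (hmaps hz).2 (hq₂ z hz) hc₂.1 hc₂.2).1
  · rw [Prod.norm_def]
    simpa [polyMap] using And.intro
      (hnear _ _ _ (hmaps hz).1 (hq₁ z hz) hc₁.1 hc₁.2).2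
      (hnear _ _ _ (hmaps hz).2 (hq₂ z hz) hc₂.1 hc₂.2).2
  · have h := hz.2
    simp only [polyMap, map_sub, MvPolynomial.eval_C, Prod.ext_iff] at h
    ext
    · simp; linarith [h.1]
    · simp; linarith [h.2]

/-- A polynomial self-map of the unit square with a fixed point and finitely many of them can be
perturbed to a polynomial self-map with exactly one further fixed point. -/
theorem exists_polyMap_near_insert_fixedPoint {p₁ p₂ : MvPolynomial (Fin 2) ℝ}
    (hmaps : MapsTo (polyMap p₁ p₂) (Icc (0 : ℝ) 1 ×ˢ Icc (0 : ℝ) 1)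
      (Icc (0 : ℝ) 1 ×ˢ Icc (0 : ℝ) 1))
    (hfin : {z ∈ Icc (0 : ℝ) 1 ×ˢ Icc (0 : ℝ) 1 | polyMap p₁ p₂ z = z}.Finite)
    (hne : {z ∈ Icc (0 : ℝ) 1 ×ˢ Icc (0 : ℝ) 1 | polyMap p₁ p₂ z = z}.Nonempty)
    {ε : ℝ} (hε : 0 < ε) :
    ∃ (r₁ r₂ : MvPolynomial (Fin 2) ℝ) (w : ℝ × ℝ),
      MapsTo (polyMap r₁ r₂) (Icc (0 : ℝ) 1 ×ˢ Icc (0 : ℝ) 1) (Icc (0 : ℝ) 1 ×ˢ Icc (0 : ℝ) 1) ∧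
      (∀ z ∈ Icc (0 : ℝ) 1 ×ˢ Icc (0 : ℝ) 1, ‖polyMap p₁ p₂ z - polyMap r₁ r₂ z‖ ≤ ε) ∧
      w ∉ {z ∈ Icc (0 : ℝ) 1 ×ˢ Icc (0 : ℝ) 1 | polyMap p₁ p₂ z = z} ∧
      {z ∈ Icc (0 : ℝ) 1 ×ˢ Icc (0 : ℝ) 1 | polyMap r₁ r₂ z = z} =
        insert w {z ∈ Icc (0 : ℝ) 1 ×ˢ Icc (0 : ℝ) 1 | polyMap p₁ p₂ z = z} := by
  set Q : Set (ℝ × ℝ) := Icc (0 : ℝ) 1 ×ˢ Icc (0 : ℝ) 1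
  set S := {z ∈ Q | polyMap p₁ p₂ z = z} with hS
  obtain ⟨z₀, hz₀, hfix⟩ := hne
  have hconv : Convex ℝ Q := (convex_Icc 0 1).prod (convex_Icc 0 1)
  have hcont : Continuous fun z => polyMap p₁ p₂ z - z :=
    (differentiable_polyMap p₁ p₂).continuous.sub continuous_id
  obtain ⟨r, hr, hball⟩ : ∃ r > 0, ∀ z, dist z z₀ < r → ‖polyMap p₁ p₂ z - z‖ < ε := by
    obtain ⟨r, hr, h⟩ := Metric.continuous_iff.1 hcont z₀ ε hε
    exact ⟨r, hr, fun z hz => by simpa [hfix] using h z hz⟩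
  obtain ⟨w, hwQ, hwS, hwz⟩ : ∃ w ∈ Q, w ∉ S ∧ dist w z₀ < r / 2 := by
    have hpre : IsPreconnected Q := hconv.isPreconnected
    have hnt : Q.Nontrivial := ⟨(0, 0), by simp [Q], (1, 1), by simp [Q], by simp⟩
    have hacc : AccPt z₀ (𝓟 Q) := hpre.preperfect_of_nontrivial hnt z₀ hz₀
    have hS' : ∀ᶠ y in 𝓝[≠] z₀, y ∈ (S \ {z₀})ᶜ := mem_nhdsWithin_of_mem_nhds
      (hfin.sdiff.isClosed.isOpen_compl.mem_nhds fun h => h.2 rfl)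
    obtain ⟨w, hwQ, ⟨hw, hwne⟩, hwr⟩ := ((accPt_iff_frequently_nhdsNE.1 hacc).and_eventually
      ((hS'.and self_mem_nhdsWithin).and
        (mem_nhdsWithin_of_mem_nhds (Metric.ball_mem_nhds z₀ (half_pos hr))))).exists
    exact ⟨w, hwQ, fun h => hw ⟨h, hwne⟩, hwr⟩
  obtain ⟨m, hm⟩ := exists_pow_lt_of_lt_one hε (show max (1 - r ^ 2 / 8) 0 < 1 from
    max_lt (by linarith [sq_pos_of_pos hr]) one_pos)
  have hm0 : m + 1 ≠ 0 := by omega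
  set s : ℝ × ℝ → ℝ := fun z => 1 - ((z.1 - w.1) ^ 2 + (z.2 - w.2) ^ 2) / 2 with hs
  have hs0 : ∀ z ∈ Q, 0 ≤ s z := fun z hz => by
    obtain ⟨⟨a1, a2⟩, a3, a4⟩ := hz
    obtain ⟨⟨b1, b2⟩, b3, b4⟩ := hwQ
    simp only [hs]
    have e1 : (z.1 - w.1) ^ 2 ≤ 1 := by rw [sq_le_one_iff_abs_le_one, abs_le]; constructor <;> linarith
    have e2 : (z.2 - w.2) ^ 2 ≤ 1 := by rw [sq_le_one_iff_abs_le_one, abs_le]; constructor <;> linarith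
    linarith
  have hs1 : ∀ z, s z ≤ 1 := fun z => by
    simp only [hs]
    linarith [sq_nonneg (z.1 - w.1), sq_nonneg (z.2 - w.2)]
  have hs_far : ∀ z, r / 2 ≤ dist z w → s z ≤ 1 - r ^ 2 / 8 := fun z hz => by
    rw [Prod.dist_eq, le_max_iff, Real.dist_eq, Real.dist_eq] at hz
    simp only [hs]
    rcases hz with hz | hz
    · have := pow_le_pow_left₀ (by positivity) hz 2
      rw [sq_abs] at this
      linarith [sq_nonneg (z.2 - w.2)]
    · have := pow_le_pow_left₀ (by positivity) hz 2
      rw [sq_abs] at this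
      linarith [sq_nonneg (z.1 - w.1)]
  let σ : MvPolynomial (Fin 2) ℝ := (1 - MvPolynomial.C (1 / 2) *
    ((MvPolynomial.X 0 - MvPolynomial.C w.1) ^ 2 + (MvPolynomial.X 1 - MvPolynomial.C w.2) ^ 2)) ^
      (m + 1)
  have hσ : ∀ z : ℝ × ℝ, MvPolynomial.eval ![z.1, z.2] σ = s z ^ (m + 1) := fun z => by
    simp [σ, hs]; ring
  have hmap : ∀ z, polyMap (p₁ + σ * (MvPolynomial.X 0 - p₁)) (p₂ + σ * (MvPolynomial.X 1 - p₂)) z =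
      polyMap p₁ p₂ z + s z ^ (m + 1) • (z - polyMap p₁ p₂ z) := fun z => by
    ext <;> simp [polyMap, hσ]
  refine ⟨p₁ + σ * (MvPolynomial.X 0 - p₁), p₂ + σ * (MvPolynomial.X 1 - p₂), w, fun z hz => ?_,
    fun z hz => ?_, hwS, ?_⟩
  · rw [hmap]
    exact hconv.add_smul_sub_mem (hmaps hz) hz ⟨pow_nonneg (hs0 z hz) _, pow_le_one₀ (hs0 z hz) (hs1 z)⟩
  · rw [hmap, sub_add_cancel_left, norm_neg, norm_smul, Real.norm_of_nonneg (pow_nonneg (hs0 z hz) _),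
      norm_sub_rev]
    rcases lt_or_ge (dist z w) (r / 2) with h | h
    · exact (mul_le_of_le_one_left (norm_nonneg _) (pow_le_one₀ (hs0 z hz) (hs1 z))).trans
        (hball z (by linarith [dist_triangle z w z₀])).le
    · have hle : ‖polyMap p₁ p₂ z - z‖ ≤ 1 := by
        obtain ⟨⟨a1, a2⟩, a3, a4⟩ := hz
        obtain ⟨⟨b1, b2⟩, b3, b4⟩ := hmaps (show z ∈ Q from ⟨⟨a1, a2⟩, a3, a4⟩)
        rw [Prod.norm_def, max_le_iff, Real.norm_eq_abs, Real.norm_eq_abs, abs_le, abs_le]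
        refine ⟨⟨?_, ?_⟩, ?_, ?_⟩ <;> simp only [Prod.fst_sub, Prod.snd_sub] <;> linarith
      calc s z ^ (m + 1) * ‖polyMap p₁ p₂ z - z‖ ≤ s z ^ (m + 1) :=
            mul_le_of_le_one_right (pow_nonneg (hs0 z hz) _) hle
        _ ≤ s z ^ m := pow_le_pow_of_le_one (hs0 z hz) (hs1 z) (Nat.le_succ m)
        _ ≤ max (1 - r ^ 2 / 8) 0 ^ m :=
            pow_le_pow_left₀ (hs0 z hz) ((hs_far z h).trans (le_max_left _ _)) m
        _ ≤ ε := hm.le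
  · ext z
    rw [mem_insert_iff, mem_ofPred_eq, hmap, hS, mem_ofPred_eq]
    have hfactor (hz : z ∈ Q) : polyMap p₁ p₂ z + s z ^ (m + 1) • (z - polyMap p₁ p₂ z) = z ↔
        s z = 1 ∨ polyMap p₁ p₂ z = z := by
      rw [← sub_eq_zero, show polyMap p₁ p₂ z + s z ^ (m + 1) • (z - polyMap p₁ p₂ z) - z =
        (1 - s z ^ (m + 1)) • (polyMap p₁ p₂ z - z) by module, smul_eq_zero, sub_eq_zero,
        sub_eq_zero, eq_comm, pow_eq_one_iff_of_nonneg (hs0 z hz) hm0]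
    have hsw : s z = 1 ↔ z = w := by
      constructor
      · intro h
        simp only [hs] at h
        have e1 : (z.1 - w.1) ^ 2 = 0 := by nlinarith [sq_nonneg (z.1 - w.1), sq_nonneg (z.2 - w.2)]
        have e2 : (z.2 - w.2) ^ 2 = 0 := by nlinarith [sq_nonneg (z.1 - w.1), sq_nonneg (z.2 - w.2)]
        exact Prod.ext (by simpa [sub_eq_zero] using e1) (by simpa [sub_eq_zero] using e2)
      · rintro rfl; simp [hs]
    constructor
    · rintro ⟨hz, h⟩
      rw [hfactor hz, hsw] at h
      exact h.imp_right fun h => ⟨hz, h⟩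
    · rintro (rfl | ⟨hz, h⟩)
      · exact ⟨hwQ, (hfactor hwQ).2 (Or.inl (hsw.2 rfl))⟩
      · exact ⟨hz, (hfactor hz).2 (Or.inr h)⟩

end

/-- Any continuous self-map of the unit square can be uniformly approximated by a
polynomial self-map of the square with a finite, odd number of fixed points. -/
theorem stmt_3
    (Q : Set (ℝ × ℝ)) (hQ : Q = Icc (0:ℝ) 1 ×ˢ Icc (0:ℝ) 1)
    (f : ℝ × ℝ → ℝ × ℝ) (hf : ContinuousOn f Q) (hfQ : MapsTo f Q Q)
    (ε : ℝ) (hε : 0 < ε) :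
    ∃ p₁ p₂ : MvPolynomial (Fin 2) ℝ,
      (∀ z ∈ Q, (MvPolynomial.eval ![z.1, z.2] p₁, MvPolynomial.eval ![z.1, z.2] p₂) ∈ Q) ∧
      (∀ z ∈ Q, ‖f z - (MvPolynomial.eval ![z.1, z.2] p₁, MvPolynomial.eval ![z.1, z.2] p₂)‖ ≤ ε) ∧
      {z ∈ Q | (MvPolynomial.eval ![z.1, z.2] p₁, MvPolynomial.eval ![z.1, z.2] p₂) = z}.Finite ∧
      Odd {z ∈ Q | (MvPolynomial.eval ![z.1, z.2] p₁, MvPolynomial.eval ![z.1, z.2] p₂) = z}.ncard := by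
  subst hQ
  obtain ⟨p₁, p₂, hmaps, hnear, hfin⟩ :=
    exists_polyMap_near_finite_fixedPoints hf hfQ (half_pos hε)
  have hmaps' := hmaps.mono_right (prod_mono Ioo_subset_Icc_self Ioo_subset_Icc_self)
  rcases Nat.even_or_odd {z ∈ Icc (0 : ℝ) 1 ×ˢ Icc (0 : ℝ) 1 | polyMap p₁ p₂ z = z}.ncard with
    heven | hodd
  · obtain ⟨r₁, r₂, w, hr, hpr, hw, heq⟩ := exists_polyMap_near_insert_fixedPoint hmaps' hfin
      (exists_fixedPoint_of_mapsTo_interior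
        (differentiable_polyMap p₁ p₂).continuous.continuousOn hmaps) (half_pos hε)
    refine ⟨r₁, r₂, hr, fun z hz => ?_, ?_, ?_⟩
    · linarith [norm_sub_le_norm_sub_add_norm_sub (f z) (polyMap p₁ p₂ z) (polyMap r₁ r₂ z),
        hnear z hz, hpr z hz]
    · exact heq ▸ hfin.insert w
    · rw [heq, ncard_insert_of_notMem hw hfin]
      exact heven.add_one
  · exact ⟨p₁, p₂, hmaps', fun z hz => (hnear z hz).trans (half_le_self hε.le), hfin, hodd⟩
end

section
/- Let Q = [0,1] × [0,1] ⊆ ℝ² and let p be a real polynomial in two variables such that p(x, y) ∈ [0,1] for all (x, y) ∈ Q, p(0, y) ≠ 0 for all y ∈ [0,1], and p(1, y) ≠ 1 for all y ∈ [0,1]. Then the set C = {(x, y) ∈ Q : p(x, y) = x} has a connected component K satisfying K ∩ ([0,1] × {0}) ≠ ∅ and K ∩ ([0,1] × {1}) ≠ ∅. -/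
open Set

/-- A real function on an interval that avoids the multiples of `π` stays between two consecutive
ones. -/
theorem mem_Ioo_of_sin_ne_zero {φ : ℝ → ℝ} {a b : ℝ} (hab : a ≤ b) (hφ : ContinuousOn φ (Icc a b))
    (hsin : ∀ t ∈ Icc a b, Real.sin (φ t) ≠ 0) (k : ℤ) :
    φ a ∈ Ioo (k * Real.pi) ((k + 1) * Real.pi) ↔ φ b ∈ Ioo (k * Real.pi) ((k + 1) * Real.pi) := by
  have avoid (m : ℤ) : ∀ t ∈ Icc a b, φ t ≠ m * Real.pi := fun t ht h ↦
    hsin t ht (h ▸ Real.sin_int_mul_pi m)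
  have side (m : ℤ) : φ a < m * Real.pi ↔ φ b < m * Real.pi := by
    constructor <;> intro h <;> by_contra! h'
    · obtain ⟨t, ht, hteq⟩ := intermediate_value_Icc hab hφ ⟨h.le, h'⟩
      exact avoid m t ht hteq
    · obtain ⟨t, ht, hteq⟩ := intermediate_value_Icc' hab hφ ⟨h.le, h'⟩
      exact avoid m t ht hteq
  have gt_iff (m : ℤ) : ∀ t ∈ Icc a b, m * Real.pi < φ t ↔ ¬ φ t < m * Real.pi := fun t ht ↦
    ⟨not_lt_of_gt, fun h ↦ (not_lt.1 h).lt_of_ne' (avoid m t ht)⟩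
  have hside := side (k + 1)
  push_cast at hside
  rw [mem_Ioo, mem_Ioo, gt_iff k a ⟨le_rfl, hab⟩, gt_iff k b ⟨hab, le_rfl⟩, side k, hside]

/-- A continuous nonvanishing planar vector field on the plane has a continuous choice of angle,
which may be taken to be the principal argument at a given point. -/
theorem exists_continuous_angle {f g : ℝ × ℝ → ℝ} (hf : Continuous f) (hg : Continuous g)
    (hne : ∀ z, f z = 0 → g z ≠ 0) (z₀ : ℝ × ℝ) :
    ∃ θ : ℝ × ℝ → ℝ, Continuous θ ∧ θ z₀ ∈ Ioc (-Real.pi) Real.pi ∧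
      ∀ z, ∃ r > 0, f z = r * Real.cos (θ z) ∧ g z = r * Real.sin (θ z) := by
  let F : C(ℝ × ℝ, ℂ) := ⟨fun z ↦ f z + g z * Complex.I, by fun_prop⟩
  have hF : ∀ z, F z ≠ 0 := fun z h ↦ by
    have hre := congrArg Complex.re h
    have him := congrArg Complex.im h
    simp only [F, ContinuousMap.coe_mk, Complex.add_re, Complex.ofReal_re, Complex.re_ofReal_mul,
      Complex.I_re, mul_zero, add_zero, Complex.zero_re, Complex.add_im, Complex.ofReal_im,
      Complex.im_ofReal_mul, Complex.I_im, mul_one, zero_add, Complex.zero_im] at hre him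
    exact hne z hre him
  obtain ⟨L, ⟨hL₀, hL⟩, -⟩ := Complex.isCoveringMapOn_exp.existsUnique_continuousMap_lifts F
    (Complex.exp_log (hF z₀)) hF
  refine ⟨fun z ↦ (L z).im, by fun_prop, ?_, fun z ↦ ⟨Real.exp (L z).re, Real.exp_pos _, ?_, ?_⟩⟩
  · simpa only [hL₀, Complex.log_im] using Complex.arg_mem_Ioc _
  · rw [← Complex.exp_re, ← Function.comp_apply (f := Complex.exp), hL]
    simp [F]
  · rw [← Complex.exp_im, ← Function.comp_apply (f := Complex.exp), hL]
    simp [F]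

/-- The Poincaré–Miranda theorem on the unit square, with strict boundary conditions. -/
theorem exists_common_zero_of_signs {f g : ℝ × ℝ → ℝ} (hf : Continuous f) (hg : Continuous g)
    (hleft : ∀ y ∈ Icc (0 : ℝ) 1, 0 < f (0, y)) (hright : ∀ y ∈ Icc (0 : ℝ) 1, f (1, y) < 0)
    (hbot : ∀ x ∈ Icc (0 : ℝ) 1, g (x, 0) < 0) (htop : ∀ x ∈ Icc (0 : ℝ) 1, 0 < g (x, 1)) :
    ∃ z ∈ Icc (0 : ℝ) 1 ×ˢ Icc (0 : ℝ) 1, f z = 0 ∧ g z = 0 := by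
  by_contra! hne
  let c : ℝ → ℝ := fun t ↦ projIcc 0 1 zero_le_one t
  have hc : Continuous c := continuous_subtype_val.comp continuous_projIcc
  have hc_mem (t : ℝ) : c t ∈ Icc (0 : ℝ) 1 := (projIcc 0 1 zero_le_one t).2
  have hc_id {t : ℝ} (ht : t ∈ Icc (0 : ℝ) 1) : c t = t := by simp [c, projIcc_of_mem _ ht]
  obtain ⟨θ, hθ, hθ₀, hpolar⟩ := exists_continuous_angle
    (f := fun z ↦ f (c z.1, c z.2)) (g := fun z ↦ g (c z.1, c z.2)) (by fun_prop) (by fun_prop)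
    (fun z ↦ hne _ ⟨hc_mem _, hc_mem _⟩) (0, 0)
  have m0 : (0 : ℝ) ∈ Icc (0 : ℝ) 1 := by simp
  have m1 : (1 : ℝ) ∈ Icc (0 : ℝ) 1 := by simp
  have cos_pos {y : ℝ} (hy : y ∈ Icc (0 : ℝ) 1) : 0 < Real.cos (θ (0, y)) := by
    obtain ⟨r, hr, h, -⟩ := hpolar (0, y)
    simp only [hc_id m0, hc_id hy] at h
    exact pos_of_mul_pos_right (h ▸ hleft y hy) hr.le
  have cos_neg {y : ℝ} (hy : y ∈ Icc (0 : ℝ) 1) : Real.cos (θ (1, y)) < 0 := by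
    obtain ⟨r, hr, h, -⟩ := hpolar (1, y)
    simp only [hc_id m1, hc_id hy] at h
    exact neg_of_mul_neg_right (h ▸ hright y hy) hr.le
  have sin_neg {x : ℝ} (hx : x ∈ Icc (0 : ℝ) 1) : Real.sin (θ (x, 0)) < 0 := by
    obtain ⟨r, hr, -, h⟩ := hpolar (x, 0)
    simp only [hc_id m0, hc_id hx] at h
    exact neg_of_mul_neg_right (h ▸ hbot x hx) hr.le
  have sin_pos {x : ℝ} (hx : x ∈ Icc (0 : ℝ) 1) : 0 < Real.sin (θ (x, 1)) := by
    obtain ⟨r, hr, -, h⟩ := hpolar (x, 1)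
    simp only [hc_id m1, hc_id hx] at h
    exact pos_of_mul_pos_right (h ▸ htop x hx) hr.le
  have bottom := mem_Ioo_of_sin_ne_zero (φ := fun x ↦ θ (x, 0)) zero_le_one
    (by fun_prop) fun x hx ↦ (sin_neg hx).ne
  have top := mem_Ioo_of_sin_ne_zero (φ := fun x ↦ θ (x, 1)) zero_le_one
    (by fun_prop) fun x hx ↦ (sin_pos hx).ne'
  have left := mem_Ioo_of_sin_ne_zero (φ := fun y ↦ θ (0, y) + Real.pi / 2) zero_le_one
    (by fun_prop) fun y hy ↦ by simpa only [Real.sin_add_pi_div_two] using (cos_pos hy).ne'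
  have right := mem_Ioo_of_sin_ne_zero (φ := fun y ↦ θ (1, y) + Real.pi / 2) zero_le_one
    (by fun_prop) fun y hy ↦ by simpa only [Real.sin_add_pi_div_two] using (cos_neg hy).ne
  have hπ := Real.pi_pos
  -- Follow the angle from `(0, 0)` to `(1, 1)`, both through `(1, 0)` and through `(0, 1)`.
  have lb_lt : θ (0, 0) < 0 := by
    by_contra! h
    exact (sin_neg m0).not_ge (Real.sin_nonneg_of_nonneg_of_le_pi h hθ₀.2)
  have lb_gt : -(Real.pi / 2) < θ (0, 0) := by
    by_contra! h
    refine (cos_pos m0).not_ge ?_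
    rw [← Real.cos_neg]
    exact Real.cos_nonpos_of_pi_div_two_le_of_le (by linarith) (by linarith [hθ₀.1])
  have rb := (bottom (-1)).1 ⟨by push_cast; linarith, by push_cast; linarith⟩
  push_cast [mem_Ioo] at rb
  have rb_lt : θ (1, 0) < -(Real.pi / 2) := by
    by_contra! h
    exact (cos_neg m0).not_ge (Real.cos_nonneg_of_neg_pi_div_two_le_of_le h (by linarith [rb.2]))
  have rt := (right (-1)).1 ⟨by push_cast; linarith [rb.1], by push_cast; linarith⟩
  push_cast [mem_Ioo] at rt
  have lt := (left 0).1 ⟨by push_cast; linarith, by push_cast; linarith⟩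
  push_cast [mem_Ioo] at lt
  have lt_gt : 0 < θ (0, 1) := by
    by_contra! h
    exact (sin_pos m0).not_ge (Real.sin_nonpos_of_nonpos_of_neg_pi_le h (by linarith [lt.1]))
  have rt' := (top 0).1 ⟨by push_cast; linarith, by push_cast; linarith [lt.2]⟩
  push_cast [mem_Ioo] at rt'
  linarith [rt.2, rt'.1]

/-- In a compact Hausdorff space, closed sets that meet no common connected component are separated
by a clopen set. -/
theorem exists_isClopen_of_disjoint_connectedComponent {X : Type*} [TopologicalSpace X]
    [CompactSpace X] [T2Space X] {S T : Set X} (hS : IsClosed S) (hT : IsClosed T)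
    (hST : ∀ x ∈ S, Disjoint (connectedComponent x) T) :
    ∃ A : Set X, IsClopen A ∧ S ⊆ A ∧ Disjoint A T := by
  have point (x : X) (hx : x ∈ S) : ∃ A : Set X, IsClopen A ∧ x ∈ A ∧ Disjoint A T := by
    refine hT.isCompact.induction_on (p := fun K ↦ ∃ A : Set X, IsClopen A ∧ x ∈ A ∧ Disjoint A K)
      ⟨univ, isClopen_univ, mem_univ x, disjoint_empty _⟩ ?_ ?_ ?_
    · rintro s t hst ⟨A, hA, hxA, hAt⟩
      exact ⟨A, hA, hxA, hAt.mono_right hst⟩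
    · rintro s t ⟨A, hA, hxA, hAs⟩ ⟨B, hB, hxB, hBt⟩
      exact ⟨A ∩ B, hA.inter hB, ⟨hxA, hxB⟩,
        (hAs.mono_left inter_subset_left).union_right (hBt.mono_left inter_subset_right)⟩
    · intro y hy
      have hyx : y ∉ connectedComponent x := fun h ↦ disjoint_left.1 (hST x hx) h hy
      rw [connectedComponent_eq_iInter_isClopen, mem_iInter, not_forall] at hyx
      obtain ⟨⟨A, hA, hxA⟩, hyA⟩ := hyx
      exact ⟨Aᶜ, mem_nhdsWithin_of_mem_nhds (hA.compl.isOpen.mem_nhds hyA), A, hA, hxA,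
        disjoint_compl_right⟩
  refine hS.isCompact.induction_on (p := fun K ↦ ∃ A : Set X, IsClopen A ∧ K ⊆ A ∧ Disjoint A T)
    ⟨∅, isClopen_empty, Subset.rfl, empty_disjoint _⟩ ?_ ?_ ?_
  · rintro s t hst ⟨A, hA, htA, hAT⟩
    exact ⟨A, hA, hst.trans htA, hAT⟩
  · rintro s t ⟨A, hA, hsA, hAT⟩ ⟨B, hB, htB, hBT⟩
    exact ⟨A ∪ B, hA.union hB, union_subset_union hsA htB, hAT.union_left hBT⟩
  · intro x hx
    obtain ⟨A, hA, hxA, hAT⟩ := point x hx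
    exact ⟨A, mem_nhdsWithin_of_mem_nhds (hA.isOpen.mem_nhds hxA), A, hA, Subset.rfl, hAT⟩

/-- The zero set of a continuous function on the unit square that is positive on the left edge and
negative on the right edge has a connected component joining the bottom edge to the top edge. -/
theorem exists_connectedComponentIn_zero_joining {f : ℝ × ℝ → ℝ} (hf : Continuous f)
    (hleft : ∀ y ∈ Icc (0 : ℝ) 1, 0 < f (0, y)) (hright : ∀ y ∈ Icc (0 : ℝ) 1, f (1, y) < 0)
    {C : Set (ℝ × ℝ)} (hC : C = {z ∈ Icc (0 : ℝ) 1 ×ˢ Icc (0 : ℝ) 1 | f z = 0}) :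
    ∃ x ∈ C, (connectedComponentIn C x ∩ (Icc (0 : ℝ) 1 ×ˢ {(0 : ℝ)})).Nonempty ∧
      (connectedComponentIn C x ∩ (Icc (0 : ℝ) 1 ×ˢ {(1 : ℝ)})).Nonempty := by
  by_contra! hcon
  have hC_compact : IsCompact C := by
    rw [hC]
    exact (isCompact_Icc.prod isCompact_Icc).inter_right (isClosed_singleton.preimage hf)
  have : CompactSpace C := isCompact_iff_compactSpace.1 hC_compact
  have hbot : IsClosed (Icc (0 : ℝ) 1 ×ˢ {(0 : ℝ)}) := isClosed_Icc.prod isClosed_singleton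
  have htop : IsClosed (Icc (0 : ℝ) 1 ×ˢ {(1 : ℝ)}) := isClosed_Icc.prod isClosed_singleton
  obtain ⟨A, hA, hbotA, hAtop⟩ := exists_isClopen_of_disjoint_connectedComponent
    (hbot.preimage (continuous_subtype_val (p := (· ∈ C))))
    (htop.preimage (continuous_subtype_val (p := (· ∈ C)))) <| by
      refine fun x hx ↦ disjoint_left.2 fun y hyx hy ↦ ?_
      have h := hcon x x.2 ⟨x, mem_connectedComponentIn x.2, hx⟩
      refine eq_empty_iff_forall_notMem.1 h y ⟨?_, hy⟩
      rw [connectedComponentIn_eq_image x.2]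
      exact mem_image_of_mem _ hyx
  have image_closed {B : Set C} (hB : IsClosed B) : IsClosed ((↑) '' B : Set (ℝ × ℝ)) :=
    (hB.isCompact.image continuous_subtype_val).isClosed
  obtain ⟨u, hu0, hu1, -⟩ := exists_continuous_zero_one_of_isClosed
    ((image_closed hA.isClosed).union hbot) ((image_closed hA.compl.isClosed).union htop) <| by
      rw [disjoint_left]
      rintro z (⟨a, ha, rfl⟩ | hz) (⟨b, hb, hba⟩ | hz')
      · exact hb (Subtype.ext hba ▸ ha)
      · exact disjoint_left.1 hAtop ha hz'
      · exact hb (hbotA (by rwa [mem_preimage, hba]))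
      · exact zero_ne_one (hz.2.symm.trans hz'.2)
  obtain ⟨z, hzQ, hfz, huz⟩ := exists_common_zero_of_signs hf (g := fun z ↦ u z - 1 / 2)
    (by fun_prop) hleft hright
    (fun x hx ↦ by norm_num [hu0 (Or.inr ⟨hx, rfl⟩ : (x, (0 : ℝ)) ∈ _)])
    (fun x hx ↦ by norm_num [hu1 (Or.inr ⟨hx, rfl⟩ : (x, (1 : ℝ)) ∈ _)])
  have hzC : z ∈ C := hC ▸ ⟨hzQ, hfz⟩
  by_cases hzA : (⟨z, hzC⟩ : C) ∈ A
  · norm_num [hu0 (Or.inl ⟨_, hzA, rfl⟩ : z ∈ _)] at huz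
  · norm_num [hu1 (Or.inl ⟨_, hzA, rfl⟩ : z ∈ _)] at huz

/-- The algebraic curve `{(x,y) ∈ Q : p(x,y) = x}` defined by a polynomial `p` mapping
`Q` into `[0,1]` with `p(0,y) ≠ 0` and `p(1,y) ≠ 1` has a connected component joining
the bottom face to the top face of the unit square. -/
theorem stmt_4
    (Q : Set (ℝ × ℝ)) (hQ : Q = Icc (0:ℝ) 1 ×ˢ Icc (0:ℝ) 1)
    (p : MvPolynomial (Fin 2) ℝ)
    (hrange : ∀ z ∈ Q, MvPolynomial.eval ![z.1, z.2] p ∈ Icc (0:ℝ) 1)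
    (h0 : ∀ y ∈ Icc (0:ℝ) 1, MvPolynomial.eval ![(0:ℝ), y] p ≠ 0)
    (h1 : ∀ y ∈ Icc (0:ℝ) 1, MvPolynomial.eval ![(1:ℝ), y] p ≠ 1) :
    ∃ x ∈ {z ∈ Q | MvPolynomial.eval ![z.1, z.2] p = z.1},
      (connectedComponentIn {z ∈ Q | MvPolynomial.eval ![z.1, z.2] p = z.1} x ∩
        (Icc (0:ℝ) 1 ×ˢ {(0:ℝ)})).Nonempty ∧
      (connectedComponentIn {z ∈ Q | MvPolynomial.eval ![z.1, z.2] p = z.1} x ∩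
        (Icc (0:ℝ) 1 ×ˢ {(1:ℝ)})).Nonempty := by
  have m0 : (0 : ℝ) ∈ Icc (0 : ℝ) 1 := by simp
  have m1 : (1 : ℝ) ∈ Icc (0 : ℝ) 1 := by simp
  subst hQ
  refine exists_connectedComponentIn_zero_joining
    (f := fun z ↦ MvPolynomial.eval ![z.1, z.2] p - z.1) ?_ (fun y hy ↦ ?_) (fun y hy ↦ ?_) ?_
  · refine (p.continuous_eval.comp ?_).sub continuous_fst
    exact continuous_pi fun i ↦ by fin_cases i <;> simp <;> fun_prop
  · simpa using (hrange (0, y) ⟨m0, hy⟩).1.lt_of_ne' (h0 y hy)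
  · simpa using (hrange (1, y) ⟨m1, hy⟩).2.lt_of_ne (h1 y hy)
  · simp only [sub_eq_zero]
end

section
/- Let Q = [0,1] × [0,1] ⊆ ℝ² and let f : Q → [0,1] be continuous. For every ε > 0 there exists a real polynomial p in two variables such that p(z) ∈ [0,1] for all z ∈ Q, |f(z) − p(z)| ≤ ε for all z ∈ Q, and moreover p(0, y) ≠ 0 and p(1, y) ≠ 1 for all y ∈ [0,1]. -/
open Set

/-- Stone–Weierstrass for polynomials in a family of continuous functions separating points. -/
theorem exists_mvPolynomial_near_of_separatesPoints {σ X : Type*} [TopologicalSpace X]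
    [CompactSpace X] (u : σ → C(X, ℝ)) (hu : ∀ x y, (∀ i, u i x = u i y) → x = y)
    (g : C(X, ℝ)) {ε : ℝ} (hε : 0 < ε) :
    ∃ p : MvPolynomial σ ℝ, ∀ x, |MvPolynomial.eval (fun i => u i x) p - g x| < ε := by
  have hsep : (MvPolynomial.aeval u : MvPolynomial σ ℝ →ₐ[ℝ] C(X, ℝ)).range.SeparatesPoints := by
    intro x y hxy
    obtain ⟨i, hi⟩ : ∃ i, u i x ≠ u i y := by
      by_contra! h
      exact hxy (hu x y h)
    exact ⟨u i, ⟨u i, ⟨MvPolynomial.X i, MvPolynomial.aeval_X u i⟩, rfl⟩, hi⟩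
  obtain ⟨⟨_, p, rfl⟩, hp⟩ :=
    ContinuousMap.exists_mem_subalgebra_near_continuous_of_separatesPoints _ hsep g
      g.continuous ε hε
  refine ⟨p, fun x => ?_⟩
  have haeval_apply : MvPolynomial.aeval u p x = MvPolynomial.eval (fun i => u i x) p :=
    MvPolynomial.map_aeval u (ContinuousMap.evalAlgHom ℝ ℝ x : C(X, ℝ) →+* ℝ) p
  rw [← haeval_apply]
  exact hp x

/-- Weierstrass-type approximation on the unit square: a continuous `f : Q → [0,1]`
can be `ε`-approximated by a polynomial taking values in `[0,1]` which avoids the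
value `0` on the face `{0} × [0,1]` and the value `1` on the face `{1} × [0,1]`. -/
theorem stmt_7
    (Q : Set (ℝ × ℝ)) (hQ : Q = Icc (0:ℝ) 1 ×ˢ Icc (0:ℝ) 1)
    (f : ℝ × ℝ → ℝ) (hf : ContinuousOn f Q) (hfQ : ∀ z ∈ Q, f z ∈ Icc (0:ℝ) 1)
    (ε : ℝ) (hε : 0 < ε) :
    ∃ p : MvPolynomial (Fin 2) ℝ,
      (∀ z ∈ Q, MvPolynomial.eval ![z.1, z.2] p ∈ Icc (0:ℝ) 1) ∧
      (∀ z ∈ Q, |f z - MvPolynomial.eval ![z.1, z.2] p| ≤ ε) ∧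
      (∀ y ∈ Icc (0:ℝ) 1, MvPolynomial.eval ![(0:ℝ), y] p ≠ 0) ∧
      (∀ y ∈ Icc (0:ℝ) 1, MvPolynomial.eval ![(1:ℝ), y] p ≠ 1) := by
  have : CompactSpace Q := by
    rw [hQ]
    exact isCompact_iff_compactSpace.mp (isCompact_Icc.prod isCompact_Icc)
  obtain ⟨δ, hδ, hδε, hδ1⟩ : ∃ δ : ℝ, 0 < δ ∧ 2 * δ ≤ ε ∧ 2 * δ ≤ 1 :=
    ⟨min ε 1 / 2, by positivity, by linarith [min_le_left ε 1], by linarith [min_le_right ε 1]⟩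
  let u : Fin 2 → C(Q, ℝ) :=
    ![⟨fun z => z.1.1, by fun_prop⟩, ⟨fun z => z.1.2, by fun_prop⟩]
  have hu : ∀ x y, (∀ i, u i x = u i y) → x = y := fun x y h =>
    Subtype.ext (Prod.ext (h 0) (h 1))
  let g : C(Q, ℝ) := ⟨fun z => (1 - 2 * δ) * f z + δ,
    (continuous_const.mul hf.domRestrict).add continuous_const⟩
  obtain ⟨p, hp⟩ := exists_mvPolynomial_near_of_separatesPoints u hu g hδ
  have key : ∀ z ∈ Q, MvPolynomial.eval ![z.1, z.2] p ∈ Ioo (0 : ℝ) 1 ∧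
      |f z - MvPolynomial.eval ![z.1, z.2] p| ≤ ε := by
    intro z hz
    have huz : (fun i => u i ⟨z, hz⟩) = ![z.1, z.2] := by
      ext i
      fin_cases i <;> rfl
    have hpz : |MvPolynomial.eval ![z.1, z.2] p - ((1 - 2 * δ) * f z + δ)| < δ :=
      huz ▸ hp ⟨z, hz⟩
    obtain ⟨h0, h1⟩ := hfQ z hz
    rw [abs_lt] at hpz
    rw [abs_le]
    refine ⟨⟨?_, ?_⟩, ?_, ?_⟩ <;> nlinarith
  refine ⟨p, fun z hz => Ioo_subset_Icc_self (key z hz).1, fun z hz => (key z hz).2,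
    fun y hy => ?_, fun y hy => ?_⟩
  · exact (key (0, y) (hQ ▸ ⟨by simp, hy⟩)).1.1.ne'
  · exact (key (1, y) (hQ ▸ ⟨by simp, hy⟩)).1.2.ne
end
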